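/- Let I = Borel(M,N) be a two-Borel ideal. Then for every monomial μ such that Γ_μ(I) is nonempty, the directed fiber graph →Γ_μ(I) (directed by the fiber sink order) has exactly one sink. -/

import Mathlib

/-!  Monomials in `K[x_1,…,x_n]` are identified with their exponent vectors in `Fin n → ℕ`
(`0`-based indexing: `x_1` corresponds to index `0`).  -/

variable {n : ℕ}

/-- Cumulative exponent vector (`0`-based): `cexp m i = m i + m (i+1) + ⋯ + m (n-1)`,
so `cexp m i` is the paper's `σ_{i+1}(m)`, and `cexp m n = 0` is the convention
`σ_{n+1}(m) = 0`. -/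
def cexp (m : Fin n → ℕ) (i : ℕ) : ℕ :=
  ∑ k : Fin n, if i ≤ (k : ℕ) then m k else 0

/-- `mshift m src tgt` is the exponent vector of `(x_tgt / x_src) · m` (only used when
`src ≠ tgt` and `x_src` divides `m`).  Thus `mshift m j i` is the Borel move `B_{j→i}(m)`
(for `i < j`) and `mshift m i j` is the reverse Borel move `RB_{i→j}(m)` (for `i < j`). -/
def mshift (m : Fin n → ℕ) (src tgt : Fin n) : Fin n → ℕ :=
  fun k => if k = tgt then m tgt + 1 else if k = src then m src - 1 else m k

/-- `BorelStep a b` : `b` is obtained from `a` by a single Borel move `B_{j→i}`, `i < j`. -/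
def BorelStep (a b : Fin n → ℕ) : Prop :=
  ∃ i j : Fin n, i < j ∧ 0 < a j ∧ b = mshift a j i

/-- `InBorel m m'` : `m ∈ Borel(m')`, i.e. `m` is obtained from `m'` by a finite (possibly
empty) sequence of Borel moves. -/
def InBorel (m m' : Fin n → ℕ) : Prop := Relation.ReflTransGen BorelStep m' m

/-- Divisibility of monomials: `m` divides `μ`. -/
def mDvd (m μ : Fin n → ℕ) : Prop := ∀ k, m k ≤ μ k

/-- `mLexLt m m'` : `m` is lexicographically smaller than `m'` (lex order with
`x_1 > x_2 > ⋯ > x_n`); i.e. `m` comes *later* than `m'` in the lex listing of monomials. -/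
def mLexLt (m m' : Fin n → ℕ) : Prop :=
  ∃ i : Fin n, (∀ k, k < i → m k = m' k) ∧ m i < m' i

/-- Total degree of a monomial. -/
def mDeg (m : Fin n → ℕ) : ℕ := ∑ k, m k

/-- A vertex of the fiber graph `Γ_μ(I)`, where `G` is the minimal monomial generating set of
`I`: a multiset of elements of `G` whose product (sum of exponent vectors) is `μ`. -/
def FiberVertex (G : Set (Fin n → ℕ)) (μ : Fin n → ℕ) (Z : Multiset (Fin n → ℕ)) : Prop :=
  (∀ w ∈ Z, w ∈ G) ∧ Z.sum = μ

/-- Adjacency in the fiber graph `Γ_μ(I)`: `Z` is obtained from `Z'` by applying a Borel move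
`B_{j→i}` to one element and the corresponding reverse Borel move `RB_{i→j}` to another,
leaving all other elements unchanged. -/
def FiberAdj (G : Set (Fin n → ℕ)) (μ : Fin n → ℕ) (Z Z' : Multiset (Fin n → ℕ)) : Prop :=
  FiberVertex G μ Z ∧ FiberVertex G μ Z' ∧
  ∃ (W : Multiset (Fin n → ℕ)) (u v u' v' : Fin n → ℕ) (i j : Fin n),
    i < j ∧ Z = u ::ₘ v ::ₘ W ∧ Z' = u' ::ₘ v' ::ₘ W ∧
    0 < u' j ∧ u = mshift u' j i ∧ 0 < v' i ∧ v = mshift v' i j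

/-- `G_M`: the minimal monomial generators of `Borel(M)`, i.e. (for the equigenerated Borel
ideal `I = Borel(M,N)`) the degree-`d` monomials in `Borel(M)`. -/
def gensM (M : Fin n → ℕ) : Set (Fin n → ℕ) := {w | InBorel w M}

/-- `G_N = gens(I) ∖ G_M` for `I = Borel(M,N)`. -/
def gensN (M N : Fin n → ℕ) : Set (Fin n → ℕ) := {w | InBorel w N ∧ ¬ InBorel w M}

/-- The minimal monomial generating set `G` of the two-Borel ideal `I = Borel(M,N)`. -/
def gens2 (M N : Fin n → ℕ) : Set (Fin n → ℕ) := {w | InBorel w M ∨ InBorel w N}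

/-- The fiber sink variable order: `varBefore M N w₁ w₂` says the variable `Y_{w₁}` comes
(strictly) before `Y_{w₂}`.  First come the `w ∈ G_N`, with `Y_N` first (lex-smaller `w`
first), then the `w ∈ G_M`, with `Y_M` last (lex-larger `w` first). -/
def varBefore (M N : Fin n → ℕ) (w₁ w₂ : Fin n → ℕ) : Prop :=
  (w₁ ∈ gensN M N ∧ w₂ ∈ gensM M) ∨
  (w₁ ∈ gensN M N ∧ w₂ ∈ gensN M N ∧ mLexLt w₁ w₂) ∨
  (w₁ ∈ gensM M ∧ w₂ ∈ gensM M ∧ mLexLt w₂ w₁)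

/-- The fiber sink order (reverse lexicographic order induced by the fiber sink variable
order): `laterThan M N Z Z'` says the monomial `∏_{w ∈ Z} Y_w` comes strictly *later* than
`∏_{w ∈ Z'} Y_w`; i.e. at the last variable (in the fiber sink variable order) where the two
multisets have different multiplicities, `Z` has the larger multiplicity. -/
def laterThan (M N : Fin n → ℕ) (Z Z' : Multiset (Fin n → ℕ)) : Prop :=
  ∃ w, Z'.count w < Z.count w ∧ ∀ u, varBefore M N w u → Z.count u = Z'.count u

/-- A sink of the directed fiber graph `→Γ_μ(I)` for `I = Borel(M,N)` (edges are directed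
toward the endpoint that is later in the fiber sink order): a vertex that is later than all
of its neighbors. -/
def IsSink (M N μ : Fin n → ℕ) (Z : Multiset (Fin n → ℕ)) : Prop :=
  FiberVertex (gens2 M N) μ Z ∧
  ∀ Z', FiberAdj (gens2 M N) μ Z Z' → Z' ≠ Z → laterThan M N Z Z'

open Relation

theorem lexLt_iff (a b : Fin n → ℕ) : mLexLt a b ↔ toLex a < toLex b := Iff.rfl

theorem mshift_add (m : Fin n → ℕ) {i j : Fin n} (hij : i ≠ j) (h : 0 < m i) :
    mshift m i j + Pi.single i 1 = m + Pi.single j 1 := by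
  funext k
  simp only [mshift, Pi.add_apply, Pi.single_apply]
  by_cases h1 : k = j
  · subst h1; simp [hij.symm]
  · by_cases h2 : k = i
    · subst h2; simp [h1]; omega
    · simp [h1, h2]

theorem cexp_add (a b : Fin n → ℕ) (t : ℕ) : cexp (a + b) t = cexp a t + cexp b t := by
  unfold cexp
  rw [← Finset.sum_add_distrib]
  refine Finset.sum_congr rfl fun k _ => ?_
  split_ifs <;> simp

theorem cexp_single (k : Fin n) (t : ℕ) :
    cexp (Pi.single k 1 : Fin n → ℕ) t = if t ≤ (k : ℕ) then 1 else 0 := by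
  unfold cexp
  rw [Finset.sum_eq_single k]
  · simp
  · intro b _ hb; simp [Pi.single_apply, hb]
  · simp

theorem cexp_zero_idx (m : Fin n → ℕ) : cexp m 0 = mDeg m := by simp [cexp, mDeg]

theorem cexp_ge (m : Fin n → ℕ) {t : ℕ} (ht : n ≤ t) : cexp m t = 0 := by
  unfold cexp
  refine Finset.sum_eq_zero fun k _ => ?_
  rw [if_neg]; have := k.2; omega

theorem cexp_anti (m : Fin n → ℕ) {s t : ℕ} (h : s ≤ t) : cexp m t ≤ cexp m s := by
  unfold cexp
  refine Finset.sum_le_sum fun k _ => ?_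
  split_ifs <;> omega

theorem cexp_add_prefix (m : Fin n → ℕ) (t : ℕ) :
    cexp m t + (∑ k : Fin n, if (k : ℕ) < t then m k else 0) = mDeg m := by
  unfold cexp mDeg
  rw [← Finset.sum_add_distrib]
  refine Finset.sum_congr rfl fun k _ => ?_
  split_ifs <;> omega

theorem cexp_succ (m : Fin n → ℕ) (k : Fin n) :
    cexp m k = m k + cexp m ((k : ℕ) + 1) := by
  have : m k = ∑ l : Fin n, if l = k then m l else 0 := by simp
  rw [this]
  unfold cexp
  rw [← Finset.sum_add_distrib]
  refine Finset.sum_congr rfl fun l _ => ?_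
  by_cases h : l = k
  · subst h; simp
  · have : (l : ℕ) ≠ k := fun h' => h (Fin.ext h')
    simp only [h, if_false]
    split_ifs <;> omega

/-- effect of a reverse Borel move on cumulative exponents -/
theorem cexp_rb (m : Fin n → ℕ) {i j : Fin n} (hij : i < j) (h : 0 < m i) (t : ℕ) :
    cexp (mshift m i j) t = cexp m t + if (i : ℕ) < t ∧ t ≤ j then 1 else 0 := by
  have := congrArg (fun f => cexp f t) (mshift_add m hij.ne h)
  simp only [cexp_add, cexp_single] at this
  have hij' : (i : ℕ) < j := hij
  split_ifs at this ⊢ <;> omega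

/-- effect of a Borel move on cumulative exponents -/
theorem cexp_b (m : Fin n → ℕ) {i j : Fin n} (hij : i < j) (h : 0 < m j) (t : ℕ) :
    cexp (mshift m j i) t + (if (i : ℕ) < t ∧ t ≤ j then 1 else 0) = cexp m t := by
  have := congrArg (fun f => cexp f t) (mshift_add m hij.ne' h)
  simp only [cexp_add, cexp_single] at this
  have hij' : (i : ℕ) < j := hij
  split_ifs at this ⊢ <;> omega

theorem mshift_inv (m : Fin n → ℕ) {i j : Fin n} (hij : i ≠ j) (h : 0 < m i) :
    mshift (mshift m i j) j i = m := by
  funext k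
  simp only [mshift]
  by_cases h1 : k = i
  · subst h1; simp [hij]; omega
  · by_cases h2 : k = j
    · subst h2; simp [h1]
    · simp [h1, h2]

theorem cexp_inj {a b : Fin n → ℕ} (h : ∀ t, cexp a t = cexp b t) : a = b := by
  funext k
  have h1 := cexp_succ a k
  have h2 := cexp_succ b k
  have h3 := h k
  have h4 := h (k + 1)
  omega

theorem InBorel.cexp_le {w P : Fin n → ℕ} (h : InBorel w P) :
    mDeg w = mDeg P ∧ ∀ t, cexp w t ≤ cexp P t := by
  unfold InBorel at h
  induction h with
  | refl => exact ⟨rfl, fun _ => le_rfl⟩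
  | tail _ hs ih =>
    obtain ⟨i, j, hij, hp, rfl⟩ := hs
    refine ⟨?_, fun t => ?_⟩
    · rw [← ih.1, ← cexp_zero_idx, ← cexp_zero_idx]
      have := cexp_b _ hij hp 0
      simpa using this
    · have := cexp_b _ hij hp t
      have := ih.2 t
      omega

theorem inBorel_of {w P : Fin n → ℕ} (hd : mDeg w = mDeg P) (h : ∀ t, cexp w t ≤ cexp P t) :
    InBorel w P := by
  generalize hs : ∑ t ∈ Finset.range n, cexp P t = s
  induction s using Nat.strong_induction_on generalizing P with
  | _ s ih =>
  by_cases hw : ∀ t, cexp w t = cexp P t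
  · rw [cexp_inj hw]; exact ReflTransGen.refl
  push Not at hw
  obtain ⟨t0, ht0⟩ := hw
  have hbd : ∀ t, cexp w t ≠ cexp P t → t ≤ n := fun t ht => by
    by_contra hc
    exact ht (by rw [cexp_ge w (by omega), cexp_ge P (by omega)])
  classical
  set q := Nat.findGreatest (fun t => cexp w t ≠ cexp P t) n with hq
  have hq1 : cexp w q ≠ cexp P q :=
    Nat.findGreatest_spec (P := fun t => cexp w t ≠ cexp P t) (hbd t0 ht0) ht0
  have hqn : q < n := by
    by_contra hc
    exact hq1 (by rw [cexp_ge w (by omega), cexp_ge P (by omega)])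
  have hq2 : cexp w (q + 1) = cexp P (q + 1) := by
    by_contra hc
    have := Nat.le_findGreatest (P := fun t => cexp w t ≠ cexp P t) (hbd _ hc) hc
    omega
  have hq0 : 0 < q := by
    rcases Nat.eq_zero_or_pos q with h0 | h0
    · rw [h0, cexp_zero_idx, cexp_zero_idx] at hq1
      exact absurd hd hq1
    · exact h0
  let j : Fin n := ⟨q, hqn⟩
  let i : Fin n := ⟨q - 1, by omega⟩
  have hij : i < j := by simp only [i, j, Fin.mk_lt_mk]; omega
  have e1 := cexp_succ w j
  have e2 := cexp_succ P j
  have e3 := h q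
  have hpj : 0 < P j := by
    simp only [j] at e1 e2 ⊢
    omega
  have hstep : BorelStep P (mshift P j i) := ⟨i, j, hij, hpj, rfl⟩
  have hc := cexp_b P hij hpj
  refine ReflTransGen.head hstep (ih (∑ t ∈ Finset.range n, cexp (mshift P j i) t) ?_ ?_ ?_ rfl)
  · rw [← hs]
    refine Finset.sum_lt_sum (fun t _ => ?_) ⟨q, by simpa using hqn, ?_⟩
    · have := hc t; omega
    · have := hc q
      rw [if_pos] at this
      · omega
      · simp only [i, j]; omega
  · have := hc 0
    simp at this
    rw [hd, ← cexp_zero_idx, ← cexp_zero_idx, this]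
  · intro t
    have h1 := hc t
    have h2 := h t
    by_cases htq : t = q
    · subst htq; split_ifs at h1 <;> omega
    · rw [if_neg] at h1
      · omega
      · simp only [i, j]; omega

theorem inBorel_iff {w P : Fin n → ℕ} :
    InBorel w P ↔ mDeg w = mDeg P ∧ ∀ t, cexp w t ≤ cexp P t :=
  ⟨InBorel.cexp_le, fun h => inBorel_of h.1 h.2⟩

theorem inBorel_b {m P : Fin n → ℕ} (hm : InBorel m P) {i j : Fin n} (hij : i < j)
    (h : 0 < m j) : InBorel (mshift m j i) P :=
  ReflTransGen.tail hm ⟨i, j, hij, h, rfl⟩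

theorem mDeg_rb {m : Fin n → ℕ} {i j : Fin n} (hij : i < j)
    (h : 0 < m i) : mDeg (mshift m i j) = mDeg m := by
  rw [← cexp_zero_idx, ← cexp_zero_idx, cexp_rb m hij h]; simp

theorem inBorel_rb {m P : Fin n → ℕ} (hm : InBorel m P) {i j : Fin n} (hij : i < j)
    (h : 0 < m i) (hlt : ∀ t : ℕ, (i : ℕ) < t → t ≤ j → cexp m t < cexp P t) :
    InBorel (mshift m i j) P := by
  rw [inBorel_iff] at hm ⊢
  refine ⟨(mDeg_rb hij h).trans hm.1, fun t => ?_⟩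
  rw [cexp_rb m hij h]
  split_ifs with hc
  · exact hlt t hc.1 hc.2
  · exact hm.2 t

theorem rb_lt (m : Fin n → ℕ) {i j : Fin n} (hij : i < j) (h : 0 < m i) :
    toLex (mshift m i j) < toLex m := by
  rw [← lexLt_iff]
  refine ⟨i, fun k hk => ?_, ?_⟩
  · simp [mshift, (hk.trans hij).ne, hk.ne]
  · simp [mshift, hij.ne]; omega

theorem b_lt (m : Fin n → ℕ) {i j : Fin n} (hij : i < j) :
    toLex m < toLex (mshift m j i) := by
  rw [← lexLt_iff]
  refine ⟨i, fun k hk => ?_, ?_⟩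
  · simp [mshift, (hk.trans hij).ne, hk.ne]
  · simp [mshift]

theorem multiset_sum_apply (Z : Multiset (Fin n → ℕ)) (j : Fin n) :
    Z.sum j = (Z.map fun u => u j).sum := by
  induction Z using Multiset.induction_on with
  | empty => simp
  | cons a s ih => simp [ih]

theorem cexp_sum (Z : Multiset (Fin n → ℕ)) (t : ℕ) :
    cexp Z.sum t = (Z.map fun u => cexp u t).sum := by
  induction Z using Multiset.induction_on with
  | empty => simp [cexp]
  | cons a s ih => simp [ih, cexp_add]

theorem mDeg_sum (Z : Multiset (Fin n → ℕ)) (d : ℕ) (h : ∀ w ∈ Z, mDeg w = d) :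
    mDeg Z.sum = Multiset.card Z * d := by
  induction Z using Multiset.induction_on with
  | empty => simp [mDeg]
  | cons a s ih =>
    rw [← cexp_zero_idx, Multiset.sum_cons, cexp_add, cexp_zero_idx, cexp_zero_idx,
      ih (fun w hw => h w (Multiset.mem_cons_of_mem hw)), h a (Multiset.mem_cons_self a s)]
    simp; ring

/-- greedy lemma -/
theorem greedy (P v : Fin n → ℕ) (W : Multiset (Fin n → ℕ)) (hv : InBorel v P)
    (hc : ∀ u ∈ W, ∀ i j : Fin n, i < j → 0 < v i → 0 < u j → ¬ InBorel (mshift v i j) P)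
    (v' : Fin n → ℕ) (hv' : InBorel v' P) (hdvd : v' ≤ (v ::ₘ W).sum) :
    toLex v ≤ toLex v' := by
  by_contra hlt
  obtain ⟨i, hi1, hi2⟩ := (lexLt_iff _ _).2 (not_le.1 hlt)
  have hd : mDeg v' = mDeg v := hv'.cexp_le.1.trans hv.cexp_le.1.symm
  have hex : ∃ j : Fin n, v j < v' j := by
    by_contra hcon
    push Not at hcon
    have : mDeg v' < mDeg v := Finset.sum_lt_sum (fun k _ => hcon k) ⟨i, Finset.mem_univ _, hi2⟩
    omega
  obtain ⟨j, hj, hmin⟩ := WellFounded.has_min (r := ((· < ·) : Fin n → Fin n → Prop))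
    wellFounded_lt {j : Fin n | v j < v' j} hex
  have hj : v j < v' j := hj
  have hij : i < j := by
    rcases lt_trichotomy i j with h | h | h
    · exact h
    · subst h; omega
    · have := hi1 j h; omega
  have hpos : ∃ u ∈ W, 0 < u j := by
    by_contra hcon
    push Not at hcon
    have h0 : W.sum j = 0 := by
      rw [multiset_sum_apply]
      refine Multiset.sum_eq_zero fun x hx => ?_
      obtain ⟨u, hu, rfl⟩ := Multiset.mem_map.1 hx
      have := hcon u hu; omega
    have h1 : v' j ≤ (v ::ₘ W).sum j := hdvd j
    rw [Multiset.sum_cons, Pi.add_apply, h0] at h1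
    omega
  obtain ⟨u, hu, huj⟩ := hpos
  refine hc u hu i j hij (by omega) huj (inBorel_rb hv hij (by omega) fun t ht1 ht2 => ?_)
  refine lt_of_lt_of_le ?_ (hv'.cexp_le.2 t)
  have e1 := cexp_add_prefix v t
  have e2 := cexp_add_prefix v' t
  have : (∑ k : Fin n, if (k : ℕ) < t then v' k else 0) <
      (∑ k : Fin n, if (k : ℕ) < t then v k else 0) := by
    refine Finset.sum_lt_sum (fun k _ => ?_) ⟨i, Finset.mem_univ _, ?_⟩
    · split_ifs with hk
      · by_contra hcon
        exact hmin k (not_le.1 hcon) (Fin.lt_def.2 (by omega))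
      · exact le_rfl
    · simp [ht1, hi2]
  omega

/-- Local sink condition. -/
def LocSink (M N : Fin n → ℕ) (Z : Multiset (Fin n → ℕ)) : Prop :=
  (∀ w ∈ Z, w ∈ gens2 M N) ∧
  ∀ u v W, Z = u ::ₘ v ::ₘ W → ∀ i j : Fin n, i < j → 0 < u j → 0 < v i →
    (InBorel v M → (InBorel u M → toLex v ≤ toLex u) → ¬ InBorel (mshift v i j) M) ∧
    (¬ InBorel v M → ¬ InBorel u M → toLex v ≤ toLex u → ¬ InBorel (mshift v i j) N)

theorem LocSink.tail {M N w : Fin n → ℕ} {Z : Multiset (Fin n → ℕ)}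
    (h : LocSink M N (w ::ₘ Z)) : LocSink M N Z := by
  refine ⟨fun x hx => h.1 x (Multiset.mem_cons_of_mem hx), fun u v W hZ => ?_⟩
  refine h.2 u v (w ::ₘ W) ?_
  rw [hZ, Multiset.cons_swap w u, Multiset.cons_swap w v]

theorem varBefore_irrefl (M N w : Fin n → ℕ) : ¬ varBefore M N w w := by
  rintro (⟨h1, h2⟩ | ⟨_, _, h⟩ | ⟨_, _, h⟩)
  · exact h1.2 h2
  · exact lt_irrefl _ ((lexLt_iff _ _).1 h)
  · exact lt_irrefl _ ((lexLt_iff _ _).1 h)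

theorem varBefore_trans {M N a b c : Fin n → ℕ} (h1 : varBefore M N a b)
    (h2 : varBefore M N b c) : varBefore M N a c := by
  rcases h1 with ⟨ha, hb⟩ | ⟨ha, hb, h1⟩ | ⟨ha, hb, h1⟩
  · rcases h2 with ⟨hb', hc⟩ | ⟨hb', hc, h2⟩ | ⟨hb', hc, h2⟩
    · exact absurd hb hb'.2
    · exact absurd hb hb'.2
    · exact Or.inl ⟨ha, hc⟩
  · rcases h2 with ⟨hb', hc⟩ | ⟨hb', hc, h2⟩ | ⟨hb', hc, h2⟩
    · exact Or.inl ⟨ha, hc⟩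
    · exact Or.inr (Or.inl ⟨ha, hc, ((lexLt_iff _ _).1 h1).trans ((lexLt_iff _ _).1 h2)⟩)
    · exact absurd hb' hb.2
  · rcases h2 with ⟨hb', hc⟩ | ⟨hb', hc, h2⟩ | ⟨hb', hc, h2⟩
    · exact absurd hb hb'.2
    · exact absurd hb hb'.2
    · exact Or.inr (Or.inr ⟨ha, hc, ((lexLt_iff _ _).1 h2).trans ((lexLt_iff _ _).1 h1)⟩)

theorem varBefore_total {M N a b : Fin n → ℕ} (ha : a ∈ gens2 M N) (hb : b ∈ gens2 M N)
    (hab : a ≠ b) : varBefore M N a b ∨ varBefore M N b a := by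
  have hlt : toLex a < toLex b ∨ toLex b < toLex a :=
    lt_or_gt_of_ne (fun h => hab (toLex.injective h))
  by_cases haM : InBorel a M
  · by_cases hbM : InBorel b M
    · exact hlt.symm.imp (fun h => Or.inr (Or.inr ⟨haM, hbM, (lexLt_iff _ _).2 h⟩))
        (fun h => Or.inr (Or.inr ⟨hbM, haM, (lexLt_iff _ _).2 h⟩))
    · exact Or.inr (Or.inl ⟨⟨hb.resolve_left hbM, hbM⟩, haM⟩)
  · have ha' : a ∈ gensN M N := ⟨ha.resolve_left haM, haM⟩
    by_cases hbM : InBorel b M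
    · exact Or.inl (Or.inl ⟨ha', hbM⟩)
    · have hb' : b ∈ gensN M N := ⟨hb.resolve_left hbM, hbM⟩
      exact hlt.imp (fun h => Or.inr (Or.inl ⟨ha', hb', (lexLt_iff _ _).2 h⟩))
        (fun h => Or.inr (Or.inl ⟨hb', ha', (lexLt_iff _ _).2 h⟩))

theorem sink_contra {M N μ : Fin n → ℕ} {Z : Multiset (Fin n → ℕ)} (hZ : IsSink M N μ Z)
    {u v : Fin n → ℕ} {W : Multiset (Fin n → ℕ)} (he : Z = u ::ₘ v ::ₘ W) {i j : Fin n}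
    (hij : i < j) (hu : 0 < u j) (hv : 0 < v i)
    (hg1 : mshift u j i ∈ gens2 M N) (hg2 : mshift v i j ∈ gens2 M N)
    (x : Fin n → ℕ) (hx : x = mshift u j i ∨ x = mshift v i j)
    (h1 : varBefore M N u x) (h2 : varBefore M N v x) : False := by
  have hxu : x ≠ u := fun h => varBefore_irrefl M N u (h ▸ h1)
  have hxv : x ≠ v := fun h => varBefore_irrefl M N v (h ▸ h2)
  set Z' := mshift v i j ::ₘ mshift u j i ::ₘ W with hZ'
  have hcount : Z.count x < Z'.count x := by
    rw [he, hZ']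
    simp only [Multiset.count_cons, hxu, hxv, if_false]
    rcases hx with h | h <;> rw [if_pos h] <;> omega
  have hsum : Z'.sum = Z.sum := by
    rw [hZ', he]
    simp only [Multiset.sum_cons]
    have e1 := mshift_add v hij.ne hv
    have e2 := mshift_add u hij.ne' hu
    funext k
    have e1 := congrFun e1 k
    have e2 := congrFun e2 k
    simp only [Pi.add_apply] at e1 e2 ⊢
    omega
  have hadj : FiberAdj (gens2 M N) μ Z Z' := by
    refine ⟨hZ.1, ⟨?_, hsum.trans hZ.1.2⟩, W, v, u, mshift v i j, mshift u j i, i, j, hij,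
      ?_, rfl, ?_, ?_, ?_, ?_⟩
    · intro w hw
      rw [hZ', Multiset.mem_cons, Multiset.mem_cons] at hw
      rcases hw with rfl | rfl | hw
      · exact hg2
      · exact hg1
      · exact hZ.1.1 w (by rw [he]; simp [hw])
    · rw [he, Multiset.cons_swap]
    · simp [mshift]
    · rw [mshift_inv v hij.ne hv]
    · simp [mshift]
    · rw [mshift_inv u hij.ne' hu]
  have hne : Z' ≠ Z := fun h => by rw [h] at hcount; exact lt_irrefl _ hcount
  obtain ⟨w, hw1, hw2⟩ := hZ.2 Z' hadj hne
  have hwx : varBefore M N w x := by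
    by_cases hwu : w = u
    · exact hwu ▸ h1
    by_cases hwv : w = v
    · exact hwv ▸ h2
    exfalso
    rw [he, hZ'] at hw1
    simp only [Multiset.count_cons, hwu, hwv, if_false] at hw1
    omega
  have := hw2 x hwx
  omega

theorem IsSink.loc {M N μ : Fin n → ℕ} {Z : Multiset (Fin n → ℕ)} (hZ : IsSink M N μ Z) :
    LocSink M N Z := by
  refine ⟨hZ.1.1, fun u v W he i j hij hu hv => ⟨fun hvM huv hM => ?_, fun hvM huM huv hN => ?_⟩⟩
  · have hug : u ∈ gens2 M N := hZ.1.1 u (by rw [he]; simp)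
    have hlt := rb_lt v hij hv
    refine sink_contra hZ he hij hu hv ?_ (Or.inl hM) _ (Or.inr rfl) ?_ ?_
    · rcases hug with h | h
      · exact Or.inl (inBorel_b h hij hu)
      · exact Or.inr (inBorel_b h hij hu)
    · by_cases huM : InBorel u M
      · exact Or.inr (Or.inr ⟨huM, hM, (lexLt_iff _ _).2 (hlt.trans_le (huv huM))⟩)
      · exact Or.inl ⟨⟨hug.resolve_left huM, huM⟩, hM⟩
    · exact Or.inr (Or.inr ⟨hvM, hM, (lexLt_iff _ _).2 hlt⟩)
  · have hug : InBorel u N := (hZ.1.1 u (by rw [he]; simp)).resolve_left huM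
    have hvg : InBorel v N := (hZ.1.1 v (by rw [he]; simp)).resolve_left hvM
    have hlt := b_lt u hij
    have hu' := inBorel_b hug hij hu
    have key : ∀ y, InBorel y N → ¬ InBorel y M → toLex y ≤ toLex u →
        varBefore M N y (mshift u j i) := by
      intro y hy hyM hyu
      by_cases hm : InBorel (mshift u j i) M
      · exact Or.inl ⟨⟨hy, hyM⟩, hm⟩
      · exact Or.inr (Or.inl ⟨⟨hy, hyM⟩, ⟨hu', hm⟩, (lexLt_iff _ _).2 (hyu.trans_lt hlt)⟩)
    exact sink_contra hZ he hij hu hv (Or.inr hu') (Or.inr hN) _ (Or.inl rfl)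
      (key u hug huM le_rfl) (key v hvg hvM huv)

theorem exists_min_lex (Z : Multiset (Fin n → ℕ)) (p : (Fin n → ℕ) → Prop)
    (h : ∃ w ∈ Z, p w) : ∃ v ∈ Z, p v ∧ ∀ w ∈ Z, p w → toLex v ≤ toLex w := by
  classical
  obtain ⟨w, hw, hp⟩ := h
  obtain ⟨v, hv, hm⟩ := Finset.exists_min_image (Z.toFinset.filter p) toLex ⟨w, by simp [hw, hp]⟩
  simp only [Finset.mem_filter, Multiset.mem_toFinset] at hv hm
  exact ⟨v, hv.1, hv.2, fun w hw hp => hm w ⟨hw, hp⟩⟩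

theorem exists_max_lex (Z : Multiset (Fin n → ℕ)) 
    (h : ∃ w, w ∈ Z) : ∃ v ∈ Z, ∀ w ∈ Z, toLex w ≤ toLex v := by
  classical
  obtain ⟨w, hw⟩ := h
  obtain ⟨v, hv, hm⟩ := Finset.exists_max_image Z.toFinset toLex ⟨w, by simp [hw]⟩
  simp only [Multiset.mem_toFinset] at hv hm
  exact ⟨v, hv, hm⟩

theorem LocSink.exM {M N : Fin n → ℕ} {Z : Multiset (Fin n → ℕ)} (h : LocSink M N Z)
    (hM : ∃ w ∈ Z, InBorel w M) : ∃ v ∈ Z, InBorel v M ∧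
      ∀ v', InBorel v' M → v' ≤ Z.sum → toLex v ≤ toLex v' := by
  obtain ⟨v, hv, hvM, hmin⟩ := exists_min_lex Z (fun w => InBorel w M) hM
  obtain ⟨W, rfl⟩ := Multiset.exists_cons_of_mem hv
  refine ⟨v, hv, hvM, fun v' hv' hd => greedy M v W hvM ?_ v' hv' hd⟩
  intro u hu i j hij hvi huj
  obtain ⟨W', rfl⟩ := Multiset.exists_cons_of_mem hu
  exact (h.2 u v W' (Multiset.cons_swap _ _ _) i j hij huj hvi).1 hvM
    (fun huM => hmin u (by simp) huM)

theorem LocSink.exN {M N : Fin n → ℕ} {Z : Multiset (Fin n → ℕ)} (h : LocSink M N Z)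
    (hM : ¬ ∃ w ∈ Z, InBorel w M) (hne : ∃ w, w ∈ Z) : ∃ v ∈ Z, InBorel v N ∧
      ∀ v', InBorel v' N → v' ≤ Z.sum → toLex v ≤ toLex v' := by
  push Not at hM
  obtain ⟨v, hv, -, hmin⟩ := exists_min_lex Z (fun _ => True) (by simpa using hne)
  obtain ⟨W, rfl⟩ := Multiset.exists_cons_of_mem hv
  have hvN := (h.1 v hv).resolve_left (hM v hv)
  refine ⟨v, hv, hvN, fun v' hv' hd => greedy N v W hvN ?_ v' hv' hd⟩
  intro u hu i j hij hvi huj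
  obtain ⟨W', rfl⟩ := Multiset.exists_cons_of_mem hu
  exact (h.2 u v W' (Multiset.cons_swap _ _ _) i j hij huj hvi).2 (hM v hv)
    (hM u (by simp)) (hmin u (by simp) trivial)

theorem gens2_deg {M N w : Fin n → ℕ} {d : ℕ} (hMd : mDeg M = d) (hNd : mDeg N = d)
    (hw : w ∈ gens2 M N) : mDeg w = d := by
  rcases hw with h | h
  · exact h.cexp_le.1.trans hMd
  · exact h.cexp_le.1.trans hNd

theorem card_eq {M N : Fin n → ℕ} {d : ℕ} (hMd : mDeg M = d) (hNd : mDeg N = d) (hd : 0 < d)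
    {Z Z' : Multiset (Fin n → ℕ)} (h : ∀ w ∈ Z, w ∈ gens2 M N) (h' : ∀ w ∈ Z', w ∈ gens2 M N)
    (hs : Z.sum = Z'.sum) : Multiset.card Z = Multiset.card Z' := by
  have e1 := mDeg_sum Z d (fun w hw => gens2_deg hMd hNd (h w hw))
  have e2 := mDeg_sum Z' d (fun w hw => gens2_deg hMd hNd (h' w hw))
  rw [hs, e2] at e1
  exact (Nat.eq_of_mul_eq_mul_right hd e1).symm

theorem LocSink.no_mix {M N : Fin n → ℕ} {d : ℕ} (hMd : mDeg M = d) (hNd : mDeg N = d)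
    (hd : 0 < d) {Z Z' : Multiset (Fin n → ℕ)} (h : LocSink M N Z)
    (h' : ∀ w ∈ Z', w ∈ gens2 M N) (hs : Z.sum = Z'.sum)
    (hM : ¬ ∃ w ∈ Z, InBorel w M) (hM' : ∃ w ∈ Z', InBorel w M) : False := by
  have hcard := card_eq hMd hNd hd h.1 h' hs
  push Not at hM
  obtain ⟨m, hm, hmM⟩ := hM'
  obtain ⟨W', rfl⟩ := Multiset.exists_cons_of_mem hm
  have hne : ∃ w, w ∈ Z := Multiset.exists_mem_of_ne_zero (by
    rintro rfl; simp at hcard)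
  obtain ⟨w, hw, hmax⟩ := exists_max_lex Z hne
  have hwN := (h.1 w hw).resolve_left (hM w hw)
  have hwM := hM w hw
  obtain ⟨W, rfl⟩ := Multiset.exists_cons_of_mem hw
  have hcard' : Multiset.card W = Multiset.card W' := by simpa using hcard
  rw [inBorel_iff] at hwM
  push Not at hwM
  obtain ⟨t0, ht0⟩ := hwM (hwN.cexp_le.1.trans (hNd.trans hMd.symm))
  have hbd : ∀ t, cexp M t < cexp w t → t < n := fun t ht => by
    by_contra hc
    rw [cexp_ge w (by omega)] at ht
    omega
  classical
  set q := Nat.findGreatest (fun t => cexp M t < cexp w t) n with hq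
  have hq1 : cexp M q < cexp w q :=
    Nat.findGreatest_spec (P := fun t => cexp M t < cexp w t) (hbd t0 ht0).le ht0
  have hqn : q < n := hbd q hq1
  have hq2 : cexp w (q + 1) ≤ cexp M (q + 1) := by
    by_contra hc
    rw [not_le] at hc
    have := Nat.le_findGreatest (P := fun t => cexp M t < cexp w t) (hbd _ hc).le hc
    omega
  have hqN : cexp M q < cexp N q := hq1.trans_le (hwN.cexp_le.2 q)
  let j : Fin n := ⟨q, hqn⟩
  have e1 := cexp_succ w j
  have e2 := cexp_succ M j
  have hwj : 0 < w j := by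
    simp only [j] at e1 e2 ⊢
    omega
  have htight : ∀ v ∈ W, cexp N q ≤ cexp v q := by
    intro v hv
    by_contra hlt
    rw [not_le] at hlt
    have hvM := hM v (by simp [hv])
    have hvN := (h.1 v (by simp [hv])).resolve_left hvM
    obtain ⟨W2, hW2⟩ := Multiset.exists_cons_of_mem hv
    have hcond := fun i hij hvi =>
      (h.2 w v W2 (by rw [hW2]) i j hij hwj hvi).2 hvM (hM w hw) (hmax v (by simp [hv]))
    have hex : (Finset.univ.filter fun i : Fin n => i < j ∧ 0 < v i).Nonempty := by
      by_contra hcon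
      rw [Finset.not_nonempty_iff_eq_empty, Finset.filter_eq_empty_iff] at hcon
      have e3 := cexp_add_prefix v q
      rw [Finset.sum_eq_zero, hvN.cexp_le.1, ← cexp_zero_idx] at e3
      · have := cexp_anti N (Nat.zero_le q); omega
      · intro k _
        split_ifs with hk
        · have := hcon (Finset.mem_univ k)
          have hkj : k < j := hk
          push Not at this
          have := this hkj; omega
        · rfl
    obtain ⟨i, hi, himax⟩ := Finset.exists_max_image _ id hex
    simp only [Finset.mem_filter, Finset.mem_univ, true_and, id] at hi himax
    refine hcond i hi.1 hi.2 (inBorel_rb hvN hi.1 hi.2 fun t ht1 ht2 => ?_)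
    have ht2 : t ≤ q := ht2
    refine lt_of_le_of_lt ?_ (hlt.trans_le (cexp_anti N ht2))
    unfold cexp
    refine Finset.sum_le_sum fun k _ => ?_
    by_cases hk : q ≤ (k : ℕ)
    · rw [if_pos hk, if_pos (ht2.trans hk)]
    · by_cases hk2 : t ≤ (k : ℕ)
      · have : v k = 0 := by
          by_contra h0
          have := himax k ⟨Fin.lt_def.2 (not_le.1 hk), Nat.pos_of_ne_zero h0⟩
          have : (k : ℕ) ≤ i := this
          omega
        simp [this]
      · simp [hk2]
  have hlow : Multiset.card W * cexp N q ≤ (W.map fun u => cexp u q).sum := by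
    have := Multiset.card_nsmul_le_sum (s := W.map fun u => cexp u q) (a := cexp N q)
      (by intro x hx; obtain ⟨u, hu, rfl⟩ := Multiset.mem_map.1 hx; exact htight u hu)
    simpa using this
  have hup : (W'.map fun u => cexp u q).sum ≤ Multiset.card W' * cexp N q := by
    have := Multiset.sum_le_card_nsmul (W'.map fun u => cexp u q) (cexp N q)
      (by
        intro x hx; obtain ⟨u, hu, rfl⟩ := Multiset.mem_map.1 hx
        rcases h' u (by simp [hu]) with hh | hh
        · exact (hh.cexp_le.2 q).trans hqN.le
        · exact hh.cexp_le.2 q)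
    simpa using this
  have hsq := congrArg (fun f => cexp f q) hs
  simp only [Multiset.sum_cons, cexp_add, cexp_sum] at hsq
  have := hmM.cexp_le.2 q
  rw [hcard'] at hlow
  omega

theorem LocSink.unique {M N : Fin n → ℕ} {d : ℕ} (hMd : mDeg M = d) (hNd : mDeg N = d)
    (hd : 0 < d) (k : ℕ) : ∀ {Z Z' : Multiset (Fin n → ℕ)}, Multiset.card Z = k →
    LocSink M N Z → LocSink M N Z' → Z.sum = Z'.sum → Z = Z' := by
  induction k with
  | zero =>
    intro Z Z' hk h h' hs
    have := card_eq hMd hNd hd h.1 h'.1 hs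
    rw [Multiset.card_eq_zero.1 hk, Multiset.card_eq_zero.1 (this.symm.trans hk)]
  | succ k ih =>
    intro Z Z' hk h h' hs
    have hc := card_eq hMd hNd hd h.1 h'.1 hs
    have hne : ∃ w, w ∈ Z := Multiset.card_pos_iff_exists_mem.1 (by omega)
    have hne' : ∃ w, w ∈ Z' := Multiset.card_pos_iff_exists_mem.1 (by omega)
    have key : ∃ v, v ∈ Z ∧ v ∈ Z' := by
      have gen : ∀ P, (∃ v ∈ Z, InBorel v P ∧
          ∀ v', InBorel v' P → v' ≤ Z.sum → toLex v ≤ toLex v') →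
          (∃ v ∈ Z', InBorel v P ∧
          ∀ v', InBorel v' P → v' ≤ Z'.sum → toLex v ≤ toLex v') → ∃ v, v ∈ Z ∧ v ∈ Z' := by
        rintro P ⟨v, hv, hvP, hm⟩ ⟨v', hv', hvP', hm'⟩
        have h1 := hm v' hvP' (hs ▸ Multiset.le_sum_of_mem hv')
        have h2 := hm' v hvP (hs ▸ Multiset.le_sum_of_mem hv)
        have : v = v' := toLex.injective (le_antisymm h1 h2)
        exact ⟨v, hv, this ▸ hv'⟩
      by_cases hM : ∃ w ∈ Z, InBorel w M
      · by_cases hM' : ∃ w ∈ Z', InBorel w M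
        · exact gen M (h.exM hM) (h'.exM hM')
        · exact (h'.no_mix hMd hNd hd h.1 hs.symm hM' hM).elim
      · by_cases hM' : ∃ w ∈ Z', InBorel w M
        · exact (h.no_mix hMd hNd hd h'.1 hs hM hM').elim
        · exact gen N (h.exN hM hne) (h'.exN hM' hne')
    obtain ⟨v, hv, hv'⟩ := key
    obtain ⟨W, rfl⟩ := Multiset.exists_cons_of_mem hv
    obtain ⟨W', rfl⟩ := Multiset.exists_cons_of_mem hv'
    rw [ih (by simpa using hk) h.tail h'.tail (by simpa using hs)]

theorem laterThan_irrefl (M N : Fin n → ℕ) (Z : Multiset (Fin n → ℕ)) :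
    ¬ laterThan M N Z Z := by
  rintro ⟨w, hw, -⟩
  exact lt_irrefl _ hw

theorem laterThan_trans {M N : Fin n → ℕ} {A B C : Multiset (Fin n → ℕ)}
    (hA : ∀ w ∈ A, w ∈ gens2 M N) (hB : ∀ w ∈ B, w ∈ gens2 M N)
    (h1 : laterThan M N A B) (h2 : laterThan M N B C) : laterThan M N A C := by
  obtain ⟨a, ha, ha'⟩ := h1
  obtain ⟨b, hb, hb'⟩ := h2
  have hag := hA a (Multiset.count_pos.1 (by omega))
  have hbg := hB b (Multiset.count_pos.1 (by omega))
  by_cases hab : a = b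
  · subst hab
    exact ⟨a, hb.trans ha, fun u hu => (ha' u hu).trans (hb' u hu)⟩
  rcases varBefore_total hag hbg hab with h | h
  · refine ⟨b, ?_, fun u hu => (ha' u (varBefore_trans h hu)).trans (hb' u hu)⟩
    rw [ha' b h]; exact hb
  · refine ⟨a, ?_, fun u hu => (ha' u hu).trans (hb' u (varBefore_trans h hu))⟩
    rw [← hb' a h]; exact ha

/-- a finite nonempty set has a maximal element for a relation that is irreflexive and
transitive on it -/
theorem exists_maximal_rel {α : Type*} (r : α → α → Prop) (S : Set α) (hS : S.Finite)
    (hne : S.Nonempty) (hirr : ∀ a, ¬ r a a)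
    (htr : ∀ a ∈ S, ∀ b ∈ S, ∀ c ∈ S, r a b → r b c → r a c) :
    ∃ m ∈ S, ∀ a ∈ S, ¬ r m a := by
  have : Finite S := hS
  let r' : S → S → Prop := fun a b => r a b
  have : IsTrans S (Function.swap r') := ⟨fun a b c h1 h2 => htr c c.2 b b.2 a a.2 h2 h1⟩
  have : Std.Irrefl (Function.swap r') := ⟨fun a => hirr a⟩
  have wf : WellFounded (Function.swap r') := Finite.wellFounded_of_trans_of_irrefl _
  obtain ⟨x, hx⟩ := hne
  obtain ⟨m, -, hm⟩ := wf.has_min Set.univ ⟨⟨x, hx⟩, trivial⟩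
  exact ⟨m, m.2, fun a ha h => hm ⟨a, ha⟩ trivial h⟩

theorem laterThan_total {M N : Fin n → ℕ} {A B : Multiset (Fin n → ℕ)}
    (hA : ∀ w ∈ A, w ∈ gens2 M N) (hB : ∀ w ∈ B, w ∈ gens2 M N) (hne : A ≠ B) :
    laterThan M N A B ∨ laterThan M N B A := by
  classical
  let S : Set (Fin n → ℕ) := {w | A.count w ≠ B.count w}
  have hSg : ∀ w ∈ S, w ∈ A ∨ w ∈ B := by
    intro w hw
    by_contra hc
    push Not at hc
    exact hw (by rw [Multiset.count_eq_zero_of_notMem hc.1, Multiset.count_eq_zero_of_notMem hc.2])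
  have hfin : S.Finite := by
    refine Set.Finite.subset (A + B).toFinset.finite_toSet fun w hw => ?_
    have := hSg w hw
    simpa using this
  have hSne : S.Nonempty := by
    by_contra hc
    rw [Set.not_nonempty_iff_eq_empty] at hc
    refine hne (Multiset.ext.2 fun w => ?_)
    by_contra hw
    have : w ∈ S := hw
    rw [hc] at this
    exact this
  obtain ⟨m, hm, hmax⟩ := exists_maximal_rel (varBefore M N) S hfin hSne (varBefore_irrefl M N)
    (fun a _ b _ c _ => varBefore_trans)
  have hcl : ∀ u, varBefore M N m u → A.count u = B.count u := by
    intro u hu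
    by_contra hc
    exact hmax u hc hu
  rcases lt_or_gt_of_ne (show A.count m ≠ B.count m from hm) with h | h
  · exact Or.inr ⟨m, h, fun u hu => (hcl u hu).symm⟩
  · exact Or.inl ⟨m, h, hcl⟩

theorem fiber_finite {M N : Fin n → ℕ} {d : ℕ} (hMd : mDeg M = d) (hNd : mDeg N = d)
    (hd : 0 < d) (μ : Fin n → ℕ) : {Z | FiberVertex (gens2 M N) μ Z}.Finite := by
  classical
  have hfin : (Set.Iic μ).Finite := Set.finite_Iic μ
  refine Set.Finite.subset
    ((mDeg μ • hfin.toFinset.val).powerset.toFinset.finite_toSet) fun Z hZ => ?_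
  simp only [Finset.mem_coe, Multiset.mem_toFinset, Multiset.mem_powerset]
  have e1 := mDeg_sum Z d (fun w hw => gens2_deg hMd hNd (hZ.1 w hw))
  rw [hZ.2] at e1
  rw [Multiset.le_iff_count]
  intro w
  by_cases hw : w ∈ Z
  · have hwμ : w ≤ μ := hZ.2 ▸ Multiset.le_sum_of_mem hw
    rw [Multiset.count_nsmul, Multiset.count_eq_one_of_mem hfin.toFinset.nodup (by simpa using hwμ)]
    have := Multiset.count_le_card w Z
    nlinarith
  · rw [Multiset.count_eq_zero_of_notMem hw]; exact Nat.zero_le _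

/-- Let `I = Borel(M,N)` be a two-Borel ideal (`M`, `N` of the same degree
`d`, `M` lex-earlier than `N`).  Then for every monomial `μ` such that `Γ_μ(I)` is
nonempty, the directed fiber graph `→Γ_μ(I)` (directed by the fiber sink order) has exactly
one sink. -/
theorem statement16 (M N : Fin n → ℕ) (d : ℕ) (hMd : mDeg M = d) (hNd : mDeg N = d)
    (hlex : mLexLt N M) :
    ∀ μ : Fin n → ℕ, (∃ Z, FiberVertex (gens2 M N) μ Z) →
      ∃! Z, IsSink M N μ Z := by
  have hd : 0 < d := by
    obtain ⟨i, -, hi⟩ := hlex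
    have h1 : M i ≤ mDeg M := Finset.single_le_sum (fun _ _ => Nat.zero_le _) (Finset.mem_univ i)
    omega
  intro μ hne
  obtain ⟨Z, hZ, hmax⟩ := exists_maximal_rel (fun A B => laterThan M N B A)
    {Z | FiberVertex (gens2 M N) μ Z} (fiber_finite hMd hNd hd μ) hne (laterThan_irrefl M N)
    (fun a ha b hb c hc h1 h2 => laterThan_trans hc.1 hb.1 h2 h1)
  have hsink : IsSink M N μ Z := by
    refine ⟨hZ, fun Z' hadj hne' => ?_⟩
    rcases laterThan_total hZ.1 hadj.2.1.1 hne'.symm with h | h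
    · exact h
    · exact absurd h (hmax Z' hadj.2.1)
  exact ⟨Z, hsink, fun Y hY =>
    LocSink.unique hMd hNd hd _ rfl hY.loc hsink.loc (hY.1.2.trans hsink.1.2.symm)⟩
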